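/- arXiv:1010.4761 — 7 statements merged into one kernel-verified Lean document; each statement's English description precedes it below -/
import Mathlib

section
/- (Theorem 3, image part) Let M be an A-module with a graded framing (f_i : M → V_i)_{i=1}^n and total map f : M → V. Then the range of Φ_{(M,f)} is contained in J, and for every i one has e_i • (range Φ_{(M,f)}) = Φ_{(M,f)}(e_i • M); consequently, if M is finite-dimensional over k and Φ_{(M,f)} is injective, then dim_k (e_i • range Φ_{(M,f)}) = dim_k (e_i • M) for all i. -/
open Module

/-- `Φ : M →ₗ[k] Hom_k(A,V)`, `Φ(m)(a) = f (a • m)` (the `k`-linear version). -/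
noncomputable def framedPhiL {k : Type*} (A : Type*) {M V : Type*} [Field k] [Ring A]
    [Algebra k A] [AddCommGroup M] [Module k M] [Module A M] [IsScalarTower k A M]
    [SMulCommClass k A M] [AddCommGroup V] [Module k V] (f : M →ₗ[k] V) :
    M →ₗ[k] (A →ₗ[k] V) where
  toFun m :=
    { toFun := fun a => f (a • m)
      map_add' := fun a b => by
        show f ((a + b) • m) = f (a • m) + f (b • m); rw [add_smul, map_add]
      map_smul' := fun c a => by
        show f ((c • a) • m) = c • f (a • m); rw [smul_assoc, map_smul] }
  map_add' m₁ m₂ := by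
    ext a; show f (a • (m₁ + m₂)) = f (a • m₁) + f (a • m₂); rw [smul_add, map_add]
  map_smul' c m := by
    ext a
    show f (a • c • m) = c • f (a • m)
    rw [← smul_comm c a m, map_smul]

/-- Left multiplication by `b : A` on an `(A,k)`-module, as a `k`-linear endomorphism. -/
def smulLeft {k : Type*} {A : Type*} {M : Type*} [Field k] [Ring A] [Algebra k A]
    [AddCommGroup M] [Module k M] [Module A M] [IsScalarTower k A M] [SMulCommClass k A M]
    (b : A) : M →ₗ[k] M where
  toFun m := b • m
  map_add' := smul_add b
  map_smul' c m := by show b • c • m = c • b • m; rw [smul_comm]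

@[simp]
theorem framedPhiL_apply {k A M V : Type*} [Field k] [Ring A] [Algebra k A] [AddCommGroup M]
    [Module k M] [Module A M] [IsScalarTower k A M] [SMulCommClass k A M] [AddCommGroup V]
    [Module k V] (f : M →ₗ[k] V) (m : M) (a : A) : framedPhiL A f m a = f (a • m) :=
  rfl

/-- `Φ` is `A`-linear: right translation by `b` on `Hom_k(A,V)` intertwines with `b • ·`. -/
theorem framedPhiL_comp_mulRight {k A M V : Type*} [Field k] [Ring A] [Algebra k A]
    [AddCommGroup M] [Module k M] [Module A M] [IsScalarTower k A M] [SMulCommClass k A M]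
    [AddCommGroup V] [Module k V] (f : M →ₗ[k] V) (b : A) (m : M) :
    framedPhiL A f m ∘ₗ LinearMap.mulRight k b = framedPhiL A f (b • m) := by
  ext a
  simp [mul_smul]

theorem map_lcomp_mulRight_range_framedPhiL {k A M V : Type*} [Field k] [Ring A] [Algebra k A]
    [AddCommGroup M] [Module k M] [Module A M] [IsScalarTower k A M] [SMulCommClass k A M]
    [AddCommGroup V] [Module k V] (f : M →ₗ[k] V) (b : A) :
    Submodule.map (LinearMap.lcomp k V (LinearMap.mulRight k b))
        (LinearMap.range (framedPhiL A f)) =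
      Submodule.map (framedPhiL A f) (Submodule.map (smulLeft (k := k) b) ⊤) := by
  rw [← Submodule.map_top, ← Submodule.map_comp, ← Submodule.map_comp]
  congr 1
  exact LinearMap.ext fun m => framedPhiL_comp_mulRight f b m

/-- (Theorem 3, image part) Let `e 1, …, e n` be complete orthogonal idempotents in `A`,
`(f i : M →ₗ[k] V i)` a graded framing of `M` with total map `F = LinearMap.pi f`, and
`J = { g : A →ₗ[k] (Π i, V i) | π j (g (e i * a)) = 0 for all a and j ≠ i }`.  Then the range of
`Φ = framedPhiL A F` is contained in `J`; moreover `e i • range Φ = Φ (e i • M)` for each `i`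
(the `A`-action on `Hom_k(A, Π i, V i)` being `(b • g)(a) = g (a * b)`), and consequently, if `M`
is finite dimensional and `Φ` is injective, then
`dim (e i • range Φ) = dim (e i • M)` for every `i`. -/
theorem framedPhiL_range_sub_J {k A M : Type*} {n : ℕ} {V : Fin n → Type*} [Field k] [Ring A]
    [Algebra k A] [AddCommGroup M] [Module k M] [Module A M] [IsScalarTower k A M]
    [SMulCommClass k A M] [∀ i, AddCommGroup (V i)] [∀ i, Module k (V i)]
    [FiniteDimensional k M]
    (e : Fin n → A) (hidem : ∀ i, e i * e i = e i)
    (horth : ∀ i j, i ≠ j → e i * e j = 0) (hsum : ∑ i, e i = 1)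
    (f : ∀ i, M →ₗ[k] V i) (hframe : ∀ i m, f i m = f i (e i • m)) :
    (∀ (m : M) (i j : Fin n) (a : A), j ≠ i →
        framedPhiL A (LinearMap.pi f) m (e i * a) j = 0) ∧
    (∀ i : Fin n,
        (fun g : A →ₗ[k] (∀ i, V i) => g ∘ₗ LinearMap.mulRight k (e i)) ''
            Set.range (framedPhiL A (LinearMap.pi f)) =
          (framedPhiL A (LinearMap.pi f)) '' Set.range (fun m : M => e i • m)) ∧
    (Function.Injective (framedPhiL A (LinearMap.pi f)) → ∀ i : Fin n,
        finrank k (Submodule.map (LinearMap.lcomp k (∀ i, V i) (LinearMap.mulRight k (e i)))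
            (LinearMap.range (framedPhiL A (LinearMap.pi f)))) =
          finrank k (Submodule.map (smulLeft (k := k) (e i)) (⊤ : Submodule k M))) := by
  refine ⟨fun m i j a hij => ?_, fun i => ?_, fun hinj i => ?_⟩
  · rw [framedPhiL_apply, LinearMap.pi_apply, hframe, smul_smul, ← mul_assoc, horth j i hij,
      zero_mul, zero_smul, map_zero]
  · rw [← Set.range_comp, ← Set.range_comp]
    exact congrArg Set.range (funext fun m => framedPhiL_comp_mulRight _ (e i) m)
  · rw [map_lcomp_mulRight_range_framedPhiL]
    exact (Submodule.equivMapOfInjective _ hinj _).finrank_eq.symm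
end

section
/- (Theorem 3, surjectivity part) Let N be an A-submodule of J. Define f_i : N → V_i by f_i(g) := π_i(g(e_i)). Then (f_i)_{i=1}^n is a graded framing of N (i.e. f_i(g) = f_i(e_i • g) for all g ∈ N), the map Φ_{(N,f)} coincides with the inclusion N ↪ Hom_k(A,V), and the pair (N,(f_i)) is stable: no nonzero A-submodule of N is contained in ∩_i ker f_i. -/
/-- If the `j`-th component of `g` vanishes on `e i * A` for all `i ≠ j`, then it only depends on
the `e j`-component of its argument. -/
theorem apply_idempotent_mul_eq {k A ι : Type*} {V : ι → Type*} [Fintype ι] [Field k]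
    [Ring A] [Algebra k A] [∀ i, AddCommGroup (V i)] [∀ i, Module k (V i)]
    {e : ι → A} (hsum : ∑ i, e i = 1) {g : A →ₗ[k] ∀ i, V i}
    (hg : ∀ i j : ι, j ≠ i → ∀ a : A, g (e i * a) j = 0) (a : A) (j : ι) :
    g (e j * a) j = g a j := by
  symm
  calc g a j = g (∑ i, e i * a) j := by rw [← Finset.sum_mul, hsum, one_mul]
    _ = ∑ i, g (e i * a) j := by rw [map_sum, Finset.sum_apply]
    _ = g (e j * a) j :=
      Fintype.sum_eq_single j fun i hij => hg i j hij.symm a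

/-- (Theorem 3, surjectivity part) Let `e 1, …, e n` be complete orthogonal idempotents in `A`,
`V = Π i, V i`, and let `J ⊆ Hom_k(A, V)` be given by
`J = { g | π j (g (e i * a)) = 0 for all a and all j ≠ i }`, an `A`-submodule for the action
`(b • g)(a) = g (a * b)` (so `b • g = g ∘ₗ mulRight b`).  Let `N` be an `A`-submodule of `J`,
i.e. a `k`-subspace of `Hom_k(A,V)` contained in `J` and stable under the `A`-action.  Define
`f i : N → V i` by `f i g = π i (g (e i))`.  Then:
(1) `(f i)` is a graded framing of `N`: `f i g = f i (e i • g)`;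
(2) `Φ_{(N,f)}` coincides with the inclusion `N ↪ Hom_k(A,V)`: for `g ∈ N`, `a : A`, `j`,
    the `j`-th component of `f (a • g)` is `π j ((a • g) (e j)) = (g a) j`;
(3) the pair `(N, (f i))` is stable: no nonzero `A`-submodule of `N` is contained in
    `∩ i, ker (f i)`. -/
theorem submoduleOfJ_framing_stable {k A : Type*} {n : ℕ} {V : Fin n → Type*} [Field k]
    [Ring A] [Algebra k A] [∀ i, AddCommGroup (V i)] [∀ i, Module k (V i)]
    (e : Fin n → A) (hidem : ∀ i, e i * e i = e i)
    (horth : ∀ i j, i ≠ j → e i * e j = 0) (hsum : ∑ i, e i = 1)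
    (N : Submodule k (A →ₗ[k] ∀ i, V i))
    (hNJ : ∀ g ∈ N, ∀ (i j : Fin n), j ≠ i → ∀ a : A, g (e i * a) j = 0)
    (hNA : ∀ b : A, ∀ g ∈ N, g ∘ₗ LinearMap.mulRight k b ∈ N) :
    (∀ g ∈ N, ∀ i : Fin n, g (e i) i = (g ∘ₗ LinearMap.mulRight k (e i)) (e i) i) ∧
    (∀ g ∈ N, ∀ (a : A) (j : Fin n), (g ∘ₗ LinearMap.mulRight k a) (e j) j = g a j) ∧
    (∀ P : Submodule k (A →ₗ[k] ∀ i, V i), P ≤ N →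
        (∀ b : A, ∀ g ∈ P, g ∘ₗ LinearMap.mulRight k b ∈ P) →
        (∀ g ∈ P, ∀ i : Fin n, g (e i) i = 0) → P = ⊥) := by
  refine ⟨fun g _ i => by simp [hidem], fun g hg a j => ?_, fun P hPN hPA hP => ?_⟩
  · simpa using apply_idempotent_mul_eq hsum (hNJ g hg) a j
  · refine (Submodule.eq_bot_iff P).2 fun g hg => ?_
    ext a j
    rw [← apply_idempotent_mul_eq hsum (hNJ g (hPN hg)) a j]
    simpa using hP _ (hPA a g hg) j
end

section
/- (Proposition 2) Assume in addition that A is finite-dimensional over k, that A = span_k{e_1,…,e_n} + rad A where rad A is the Jacobson radical of A (i.e. A is split basic with respect to the e_i), that M is a finite-dimensional A-module, and that the V_i are finite-dimensional. Then there exists a graded framing (f_i : M → V_i) making the pair (M,(f_i)) stable if and only if dim_k (e_i • soc M) ≤ dim_k V_i for every i, where soc M denotes the socle of M, the sum of all simple A-submodules of M. -/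
open Module

/-- The socle of an `A`-module `M`: the sum of all simple `A`-submodules of `M`. -/
def moduleSocle (A M : Type*) [Ring A] [AddCommGroup M] [Module A M] : Submodule A M :=
  sSup {N : Submodule A M | IsSimpleModule A ↥N}

/-- The Jacobson radical of the ring annihilates the socle. -/
theorem smul_eq_zero_of_mem_moduleSocle {A M : Type*} [Ring A] [AddCommGroup M] [Module A M]
    {r : A} (hr : r ∈ Ideal.jacobson (⊥ : Ideal A)) {m : M} (hm : m ∈ moduleSocle A M) :
    r • m = 0 := by
  have hss : IsSemisimpleModule A ↥(moduleSocle A M) := by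
    rw [moduleSocle, sSup_eq_iSup]
    refine isSemisimpleModule_biSup_of_isSemisimpleModule_submodule fun N hN ↦ ?_
    have : IsSimpleModule A ↥N := hN
    infer_instance
  rw [Ideal.jacobson_bot] at hr
  have h := Module.mem_annihilator.mp
    (IsSemisimpleModule.jacobson_le_annihilator A ↥(moduleSocle A M) hr) ⟨m, hm⟩
  simpa using congrArg Subtype.val h

/-- In an Artinian module, a submodule meeting the socle trivially is zero. -/
theorem eq_bot_of_disjoint_moduleSocle {A M : Type*} [Ring A] [AddCommGroup M] [Module A M]
    [IsArtinian A M] {N : Submodule A M} (h : ∀ m ∈ N, m ∈ moduleSocle A M → m = 0) :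
    N = ⊥ := by
  obtain hN | ⟨T, hT, hTN⟩ := eq_bot_or_exists_atom_le N
  · exact hN
  · refine absurd ((Submodule.eq_bot_iff T).mpr fun m hm ↦ h m (hTN hm) ?_) hT.1
    exact le_sSup (show T ∈ {N : Submodule A M | IsSimpleModule A ↥N} from
      isSimpleModule_iff_isAtom.mpr hT) hm

/-- If `A` is split basic with respect to `e`, then every element of `A` acts as a scalar on the
part of the socle fixed by `e i`. -/
theorem exists_smul_eq_of_mem_moduleSocle {k A M : Type*} {n : ℕ} [Field k] [Ring A]
    [Algebra k A] [AddCommGroup M] [Module k M] [Module A M] [IsScalarTower k A M]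
    {e : Fin n → A} (horth : ∀ i j, i ≠ j → e i * e j = 0)
    (hbasic : Submodule.span k (Set.range e) ⊔
        Submodule.restrictScalars k (Ideal.jacobson (⊥ : Ideal A)) = ⊤)
    {i : Fin n} {m : M} (hm : m ∈ moduleSocle A M) (him : e i • m = m) (a : A) :
    ∃ c : k, a • m = c • m := by
  obtain ⟨b, hb, r, hr, rfl⟩ := Submodule.mem_sup.mp (hbasic ▸ Submodule.mem_top : a ∈ _)
  rw [add_smul, smul_eq_zero_of_mem_moduleSocle hr hm, add_zero]
  induction hb using Submodule.span_induction with
  | mem x hx =>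
    obtain ⟨j, rfl⟩ := hx
    by_cases hji : j = i
    · exact ⟨1, by rw [hji, him, one_smul]⟩
    · exact ⟨0, by rw [← him, smul_smul, horth j i hji, zero_smul, zero_smul]⟩
  | zero => exact ⟨0, by simp⟩
  | add x y _ _ hx hy =>
    obtain ⟨c, hc⟩ := hx
    obtain ⟨d, hd⟩ := hy
    exact ⟨c + d, by rw [add_smul, add_smul, hc, hd]⟩
  | smul t x _ hx =>
    obtain ⟨c, hc⟩ := hx
    exact ⟨t * c, by rw [smul_assoc, hc, mul_smul]⟩

/-- (Proposition 2) Let `A` be a finite-dimensional algebra over `k`, with complete orthogonal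
idempotents `e 1, …, e n` such that `A = span_k {e 1, …, e n} + rad A` (`A` is split basic), let
`M` be a finite-dimensional `A`-module, and let the `V i` be finite-dimensional.  Then there is a
graded framing `(f i : M →ₗ[k] V i)` making the pair `(M, (f i))` stable if and only if
`dim_k (e i • soc M) ≤ dim_k (V i)` for every `i`. -/
theorem exists_stable_framing_iff_socle {k A M : Type*} {n : ℕ} {V : Fin n → Type*} [Field k]
    [Ring A] [Algebra k A] [FiniteDimensional k A]
    [AddCommGroup M] [Module k M] [Module A M] [IsScalarTower k A M] [SMulCommClass k A M]
    [FiniteDimensional k M]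
    [∀ i, AddCommGroup (V i)] [∀ i, Module k (V i)] [∀ i, FiniteDimensional k (V i)]
    (e : Fin n → A) (hidem : ∀ i, e i * e i = e i)
    (horth : ∀ i j, i ≠ j → e i * e j = 0) (hsum : ∑ i, e i = 1)
    (hbasic : Submodule.span k (Set.range e) ⊔
        Submodule.restrictScalars k (Ideal.jacobson (⊥ : Ideal A)) = ⊤) :
    (∃ f : ∀ i, M →ₗ[k] V i, (∀ i m, f i m = f i (e i • m)) ∧
        ∀ N : Submodule A M, (∀ m ∈ N, ∀ i, f i m = 0) → N = ⊥) ↔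
      ∀ i : Fin n,
        finrank k (Submodule.map (smulLeft (k := k) (e i))
            (Submodule.restrictScalars k (moduleSocle A M))) ≤ finrank k (V i) := by
  constructor
  · rintro ⟨f, hf, hstable⟩ i
    refine LinearMap.finrank_le_finrank_of_injective
      (f := (f i).domRestrict _) ((injective_iff_map_eq_zero _).mpr ?_)
    rintro ⟨_, m, hm, rfl⟩ hfm
    replace hfm : f i (e i • m) = 0 := hfm
    have him : e i • e i • m = e i • m := by rw [smul_smul, hidem]
    have hsoc : e i • m ∈ moduleSocle A M := Submodule.smul_mem _ _ hm
    have hspan : Submodule.span A {e i • m} = ⊥ := by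
      refine hstable _ fun x hx j ↦ ?_
      obtain ⟨a, rfl⟩ := Submodule.mem_span_singleton.mp hx
      obtain ⟨c, hc⟩ := exists_smul_eq_of_mem_moduleSocle horth hbasic hsoc him a
      rw [hc, map_smul]
      by_cases hji : j = i
      · rw [hji, hfm, smul_zero]
      · rw [hf j, smul_smul, horth j i hji, zero_smul, map_zero, smul_zero]
    exact Subtype.ext (Submodule.span_singleton_eq_bot.mp hspan)
  · intro h
    have : IsArtinian A M := isArtinian_of_tower k inferInstance
    have hg (i : Fin n) : ∃ g : M →ₗ[k] V i,
        ∀ m ∈ moduleSocle A M, g (e i • m) = 0 → e i • m = 0 := by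
      obtain ⟨g, hg⟩ := (lift_rank_le_iff_exists_linearMap (R := k) (M' := V i)
        (M := Submodule.map (smulLeft (k := k) (e i))
          (Submodule.restrictScalars k (moduleSocle A M)))).mp
        (by simpa [← finrank_eq_rank] using h i)
      obtain ⟨g', rfl⟩ := LinearMap.exists_extend g
      refine ⟨g', fun m hm hgm ↦ ?_⟩
      exact congrArg Subtype.val
        ((injective_iff_map_eq_zero _).mp hg ⟨e i • m, m, hm, rfl⟩ hgm)
    choose g hg using hg
    refine ⟨fun i ↦ g i ∘ₗ smulLeft (e i), fun i m ↦ ?_, fun N hN ↦ ?_⟩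
    · change g i (e i • m) = g i (e i • e i • m)
      rw [smul_smul, hidem]
    · refine eq_bot_of_disjoint_moduleSocle fun m hmN hm ↦ ?_
      rw [← one_smul A m, ← hsum, Finset.sum_smul]
      exact Finset.sum_eq_zero fun i _ ↦ hg i m hm (hN m hmN i)
end

section
/- (Proposition 4, key claim) Let k be a field of characteristic zero, V a k-vector space of finite dimension n, and S a set of k-linear endomorphisms of V such that the composition of every nonempty finite sequence of elements of S (repetitions allowed) is a nilpotent endomorphism. Then the composition of any n elements of S (repetitions allowed) is the zero endomorphism. -/
open Module

open Polynomial in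
/-- In characteristic zero, an endomorphism all of whose positive powers have trace zero is
nilpotent. -/
theorem Module.End.isNilpotent_of_trace_pow_eq_zero {k V : Type*} [Field k] [CharZero k]
    [AddCommGroup V] [Module k V] [FiniteDimensional k V] (a : Module.End k V)
    (h : ∀ m : ℕ, LinearMap.trace k V (a ^ (m + 1)) = 0) : IsNilpotent a := by
  obtain ⟨q, hq, hdvd⟩ := exists_eq_pow_rootMultiplicity_mul_and_not_dvd (LinearMap.charpoly a)
    (LinearMap.charpoly_monic a).ne_zero 0
  set m := rootMultiplicity 0 (LinearMap.charpoly a)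
  rw [C_0, sub_zero] at hq hdvd
  have hcop : IsCoprime (X ^ (m + 1) : k[X]) q :=
    (((Polynomial.irreducible_X).coprime_iff_not_dvd).2 hdvd).pow_left
  obtain ⟨u, v, huv⟩ := hcop
  have hzero : aeval a (X ^ m * q) = 0 := by
    rw [← hq]; exact LinearMap.aeval_self_charpoly a
  have hidem : IsIdempotentElem (aeval a (u * X ^ (m + 1))) := by
    have key : u * X ^ (m + 1) * (u * X ^ (m + 1)) =
        u * X ^ (m + 1) - u * v * X * (X ^ m * q) := by
      linear_combination (u * X ^ (m + 1)) * huv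
    rw [IsIdempotentElem, ← map_mul, key, map_sub, map_mul _ _ (X ^ m * q), hzero, mul_zero,
      sub_zero]
  have htrace : LinearMap.trace k V (aeval a (u * X ^ (m + 1))) = 0 := by
    have hlin (w : k[X]) : LinearMap.trace k V (aeval a (w * X ^ (m + 1))) = 0 := by
      induction w using Polynomial.induction_on' with
      | add p q hp hq => rw [add_mul, map_add, map_add, hp, hq, add_zero]
      | monomial n c =>
        rw [X_pow_eq_monomial, monomial_mul_monomial, mul_one, ← C_mul_X_pow_eq_monomial,
          ← smul_eq_C_mul, map_smul, aeval_X_pow, map_smul, ← add_assoc, h, smul_zero]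
    exact hlin u
  have he := LinearMap.IsIdempotentElem.eq_zero_of_trace_eq_zero hidem htrace
  refine ⟨m, ?_⟩
  have key : (X : k[X]) ^ m = X ^ m * (u * X ^ (m + 1)) + v * (X ^ m * q) := by
    linear_combination -(X ^ m) * huv
  rw [← aeval_X_pow (R := k) a, key, map_add, map_mul, he, map_mul, hzero]
  simp

/-- The lower central series of a nilpotent Lie module of dimension `n` vanishes from index `n`
on. -/
theorem LieModule.lowerCentralSeries_finrank_eq_bot (k L V : Type*) [Field k] [LieRing L]
    [LieAlgebra k L] [AddCommGroup V] [Module k V] [FiniteDimensional k V] [LieRingModule L V]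
    [LieModule k L V] [LieModule.IsNilpotent L V] :
    lowerCentralSeries k L V (finrank k V) = ⊥ := by
  have step (i : ℕ) : lowerCentralSeries k L V i = ⊥ ∨
      finrank k (lowerCentralSeries k L V i) + i ≤ finrank k V := by
    induction i with
    | zero => exact Or.inr (Submodule.finrank_le (lowerCentralSeries k L V 0).toSubmodule)
    | succ i ih =>
      have hle := antitone_lowerCentralSeries k L V (Nat.le_succ i)
      rcases ih with ih | ih
      · exact Or.inl (le_bot_iff.1 (ih ▸ hle))
      rcases hle.eq_or_lt with heq | hlt
      · left
        have hstable (j : ℕ) : lowerCentralSeries k L V (i + j) = lowerCentralSeries k L V i := by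
          induction j with
          | zero => rfl
          | succ j ihj =>
            rw [← add_assoc, lowerCentralSeries_succ, ihj, ← lowerCentralSeries_succ]
            exact heq
        obtain ⟨N, hN⟩ := LieModule.IsNilpotent.nilpotent k L V
        refine heq.trans ?_
        rw [← hstable N, ← le_bot_iff, ← hN]
        exact antitone_lowerCentralSeries k L V (Nat.le_add_left N i)
      · right
        have := Submodule.finrank_lt_finrank_of_lt
          (s := (lowerCentralSeries k L V (i + 1)).toSubmodule)
          (t := (lowerCentralSeries k L V i).toSubmodule) hlt
        change finrank k (lowerCentralSeries k L V (i + 1)).toSubmodule + (i + 1) ≤ _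
        change finrank k (lowerCentralSeries k L V i).toSubmodule + i ≤ _ at ih
        omega
  rcases step (finrank k V) with h | h
  · exact h
  · rw [← LieSubmodule.toSubmodule_eq_bot]
    refine Submodule.finrank_eq_zero.1 ?_
    change finrank k (lowerCentralSeries k L V _).toSubmodule + _ ≤ _ at h
    omega

attribute [local instance] LieRing.ofAssociativeRing in
/-- A product of `dim V` elements of a non-unital algebra of nilpotent endomorphisms of `V` is
zero. -/
theorem NonUnitalSubalgebra.list_prod_eq_zero_of_forall_isNilpotent {k V : Type*} [Field k]
    [AddCommGroup V] [Module k V] [FiniteDimensional k V]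
    (A : NonUnitalSubalgebra k (Module.End k V)) (hA : ∀ a ∈ A, IsNilpotent a)
    (l : List (Module.End k V)) (hlen : l.length = finrank k V) (hl : ∀ x ∈ l, x ∈ A) :
    l.prod = 0 := by
  let L : LieSubalgebra k (Module.End k V) :=
    { A.toSubmodule with
      lie_mem' := fun {x y} hx hy => by
        rw [LieRing.of_associative_ring_bracket]
        exact A.sub_mem (A.mul_mem hx hy) (A.mul_mem hy hx) }
  have : LieModule.IsNilpotent L V :=
    (LieModule.isNilpotent_iff_forall' (R := k)).2 fun x => hA _ x.2
  have hmem (l : List (Module.End k V)) (hl : ∀ x ∈ l, x ∈ A) (v : V) :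
      l.prod v ∈ LieModule.lowerCentralSeries k L V l.length := by
    induction l with
    | nil => simp
    | cons x l ih =>
      rw [List.prod_cons, List.length_cons, LieModule.lowerCentralSeries_succ]
      exact LieSubmodule.lie_mem_lie (x := (⟨x, hl x (by simp)⟩ : L)) (LieSubmodule.mem_top _)
        (ih fun y hy => hl y (List.mem_cons_of_mem _ hy))
  ext v
  have := hmem l hl v
  rwa [hlen, LieModule.lowerCentralSeries_finrank_eq_bot, LieSubmodule.mem_bot] at this

/-- In characteristic zero, if every nonempty word in `S` is nilpotent, then so is every element
of the non-unital algebra generated by `S`. -/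
theorem NonUnitalAlgebra.isNilpotent_of_mem_adjoin {k V : Type*} [Field k] [CharZero k]
    [AddCommGroup V] [Module k V] [FiniteDimensional k V] {S : Set (Module.End k V)}
    (hnil : ∀ l : List (Module.End k V), l ≠ [] → (∀ x ∈ l, x ∈ S) → IsNilpotent l.prod)
    {a : Module.End k V} (ha : a ∈ NonUnitalAlgebra.adjoin k S) : IsNilpotent a := by
  have hword {w : Module.End k V} (hw : w ∈ Subsemigroup.closure S) :
      ∃ l : List (Module.End k V), l ≠ [] ∧ (∀ x ∈ l, x ∈ S) ∧ l.prod = w := by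
    induction hw using Subsemigroup.closure_induction with
    | mem x hx => exact ⟨[x], by simp, by simpa using hx, by simp⟩
    | mul x y _ _ hx hy =>
      obtain ⟨l, hl, hlS, rfl⟩ := hx
      obtain ⟨l', -, hlS', rfl⟩ := hy
      exact ⟨l ++ l', by simp [hl], fun x hx => (List.mem_append.1 hx).elim (hlS x) (hlS' x),
        List.prod_append⟩
  have htrace {b : Module.End k V} (hb : b ∈ NonUnitalAlgebra.adjoin k S) :
      LinearMap.trace k V b = 0 := by
    have hb' : b ∈ Submodule.span k (Subsemigroup.closure S : Set (Module.End k V)) := by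
      rw [← NonUnitalAlgebra.adjoin_eq_span]; exact hb
    rw [← LinearMap.mem_ker]
    refine Submodule.span_le.2 (fun w hw => ?_) hb'
    obtain ⟨l, hl, hlS, rfl⟩ := hword hw
    exact (LinearMap.isNilpotent_trace_of_isNilpotent (hnil l hl hlS)).eq_zero
  refine Module.End.isNilpotent_of_trace_pow_eq_zero a fun m => htrace ?_
  induction m with
  | zero => simpa using ha
  | succ m ih => rw [pow_succ]; exact mul_mem ih ha

/-- (Proposition 4, key claim) Let `k` be a field of characteristic zero, `V` a `k`-vector space
of finite dimension `n`, and `S` a set of `k`-linear endomorphisms of `V` such that the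
composition of every nonempty finite sequence of elements of `S` (repetitions allowed) is
nilpotent.  Then the composition of any `n` elements of `S` (repetitions allowed) is zero. -/
theorem prod_eq_zero_of_all_words_nilpotent {k V : Type*} [Field k] [CharZero k]
    [AddCommGroup V] [Module k V] [FiniteDimensional k V] {n : ℕ} (hn : finrank k V = n)
    (S : Set (Module.End k V))
    (hnil : ∀ l : List (Module.End k V), l ≠ [] → (∀ x ∈ l, x ∈ S) → IsNilpotent l.prod) :
    ∀ l : List (Module.End k V), l.length = n → (∀ x ∈ l, x ∈ S) → l.prod = 0 := by
  intro l hlen hl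
  exact NonUnitalSubalgebra.list_prod_eq_zero_of_forall_isNilpotent (NonUnitalAlgebra.adjoin k S)
    (fun _ ha => NonUnitalAlgebra.isNilpotent_of_mem_adjoin hnil ha) l (hlen.trans hn.symm)
    fun x hx => NonUnitalAlgebra.subset_adjoin k (hl x hx)
end

section
/- (Lemma 7) Let n ≥ 1 and let M_0, …, M_{n−1} be finite-dimensional ℂ-vector spaces with ℂ-linear maps a_i : M_i → M_{i+1 mod n} for each i. For each i let τ_i : M_i → M_i be the once-around-the-cycle composition τ_i = a_{i−1} ∘ ⋯ ∘ a_{i+1} ∘ a_i (indices taken mod n). Then for every λ ∈ ℂ with λ ≠ 0, the dimension of the generalized eigenspace of τ_i for λ (the union over N of ker((τ_i − λ·id)^N)) is the same for all i. -/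
open Module

/-- The "one step around the cycle" endomorphism of `Π i, M i` associated to a cyclically
indexed family of linear maps `a j : M (j-1) → M j` (so `a j` is the arrow of the cyclic quiver
`A_{n-1}^{(1)}` ending at the vertex `j`): its `j`-th component of the image of `x` is
`a j (x (j-1))`. -/
noncomputable def cycleStep {n : ℕ} [NeZero n] {M : ZMod n → Type*} [∀ i, AddCommGroup (M i)]
    [∀ i, Module ℂ (M i)] (a : ∀ j : ZMod n, M (j - 1) →ₗ[ℂ] M j) :
    Module.End ℂ (∀ i, M i) :=
  LinearMap.pi fun j => (a j).comp (LinearMap.proj (j - 1))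

/-- The once-around-the-cycle composition `τ_i = a_{i-1} ∘ ⋯ ∘ a_{i+1} ∘ a_i : M i → M i`
starting at the vertex `i`, obtained by composing the cycle maps `n` times and restricting to
the `i`-th component (since going `n` steps around the cycle returns to `i`). -/
noncomputable def cycleTau {n : ℕ} [NeZero n] {M : ZMod n → Type*} [∀ i, AddCommGroup (M i)]
    [∀ i, Module ℂ (M i)] (a : ∀ j : ZMod n, M (j - 1) →ₗ[ℂ] M j) (i : ZMod n) :
    Module.End ℂ (M i) :=
  (LinearMap.proj i).comp ((cycleStep a ^ n).comp (LinearMap.single ℂ M i))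

/-- If `f` intertwines `S` and `T` and `S` vanishes on the kernel of `f`, then for `μ ≠ 0` the map
`f` embeds the generalized eigenspace of `S` for `μ` into that of `T`. -/
lemma finrank_maxGenEigenspace_le_of_intertwines {K V W : Type*} [Field K]
    [AddCommGroup V] [Module K V] [AddCommGroup W] [Module K W] [FiniteDimensional K W]
    {S : Module.End K V} {T : Module.End K W} (f : V →ₗ[K] W)
    (hf : ∀ x, f (S x) = T (f x)) (hker : ∀ x, f x = 0 → S x = 0) {μ : K} (hμ : μ ≠ 0) :
    finrank K (S.maxGenEigenspace μ) ≤ finrank K (T.maxGenEigenspace μ) := by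
  have hpow : ∀ (k : ℕ) (x : V), f (((S - μ • (1 : Module.End K V)) ^ k) x) =
      ((T - μ • (1 : Module.End K W)) ^ k) (f x) := by
    intro k
    induction k with
    | zero => simp
    | succ k ih => intro x; simp [pow_succ, ih, hf]
  have hmaps : ∀ x ∈ S.maxGenEigenspace μ, f x ∈ T.maxGenEigenspace μ := by
    intro x hx
    rw [End.mem_maxGenEigenspace] at hx ⊢
    obtain ⟨k, hk⟩ := hx
    exact ⟨k, by rw [← hpow, hk, map_zero]⟩
  refine LinearMap.finrank_le_finrank_of_injective (f := f.restrict hmaps) ?_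
  rw [← LinearMap.ker_eq_bot, LinearMap.ker_eq_bot']
  rintro ⟨x, hx⟩ h
  have hx0 : x ∈ S.maxGenEigenspace 0 :=
    (End.mem_maxGenEigenspace _ _ _).2 ⟨1, by simpa using hker x (congrArg Subtype.val h)⟩
  exact Subtype.ext (Submodule.disjoint_def.1 (S.disjoint_genEigenspace hμ ⊤ ⊤) x hx hx0)

section CycleStep

variable {n : ℕ} [NeZero n] {M : ZMod n → Type*} [∀ i, AddCommGroup (M i)]
  [∀ i, Module ℂ (M i)] (a : ∀ j : ZMod n, M (j - 1) →ₗ[ℂ] M j)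

lemma cycleStep_apply (y : ∀ i, M i) (j : ZMod n) : cycleStep a y j = a j (y (j - 1)) := rfl

lemma cycleStep_single (j : ZMod n) (x : M (j - 1)) :
    cycleStep a (Pi.single (j - 1) x) = Pi.single j (a j x) := by
  ext k
  rw [cycleStep_apply]
  by_cases h : k = j
  · subst h; simp
  · rw [Pi.single_eq_of_ne h, Pi.single_eq_of_ne (sub_left_injective.ne h), map_zero]

lemma cycleStep_pow_single_apply_of_ne (i : ZMod n) (x : M i) (k : ℕ) {m : ZMod n}
    (h : m ≠ i + k) : (cycleStep a ^ k) (Pi.single i x) m = 0 := by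
  induction k generalizing m with
  | zero => simpa using Pi.single_eq_of_ne (by simpa using h) x
  | succ k ih =>
    rw [pow_succ', Module.End.mul_apply, cycleStep_apply, ih, map_zero]
    contrapose! h
    rw [Nat.cast_succ, ← add_assoc, ← h, sub_add_cancel]

lemma cycleStep_pow_single (i : ZMod n) (x : M i) :
    (cycleStep a ^ n) (Pi.single i x) = Pi.single i (cycleTau a i x) := by
  ext m
  by_cases h : m = i
  · subst h; simp [cycleTau]
  · rw [Pi.single_eq_of_ne h, cycleStep_pow_single_apply_of_ne a i x n (by simpa using h)]

lemma map_cycleTau (j : ZMod n) (x : M (j - 1)) :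
    a j (cycleTau a (j - 1) x) = cycleTau a j (a j x) := by
  apply Pi.single_injective j
  rw [← cycleStep_single, ← cycleStep_pow_single, ← cycleStep_pow_single, ← cycleStep_single,
    ← Module.End.mul_apply, ← Module.End.mul_apply, pow_mul_comm']

lemma cycleTau_eq_zero_of_map_eq_zero (j : ZMod n) (x : M (j - 1)) (h : a j x = 0) :
    cycleTau a (j - 1) x = 0 := by
  apply Pi.single_injective (j - 1)
  rw [← cycleStep_pow_single, ← pow_sub_one_mul (NeZero.ne n), Module.End.mul_apply,
    cycleStep_single, h, Pi.single_zero, Pi.single_zero, map_zero]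

lemma finrank_maxGenEigenspace_cycleTau_le [∀ i, FiniteDimensional ℂ (M i)] {μ : ℂ} (hμ : μ ≠ 0)
    (i j : ZMod n) :
    finrank ℂ ((cycleTau a i).maxGenEigenspace μ) ≤
      finrank ℂ ((cycleTau a j).maxGenEigenspace μ) := by
  have hstep (j : ZMod n) := finrank_maxGenEigenspace_le_of_intertwines (a j) (map_cycleTau a j)
    (cycleTau_eq_zero_of_map_eq_zero a j) hμ
  have hadd (k : ℕ) : finrank ℂ ((cycleTau a i).maxGenEigenspace μ) ≤
      finrank ℂ ((cycleTau a (i + k)).maxGenEigenspace μ) := by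
    induction k with
    | zero => rw [Nat.cast_zero, add_zero]
    | succ k ih =>
      have h := hstep (i + (k + 1 : ℕ))
      rw [show i + ((k + 1 : ℕ) : ZMod n) - 1 = i + k by push_cast; ring] at h
      exact ih.trans h
  have h := hadd (j - i).val
  rwa [ZMod.natCast_zmod_val, add_sub_cancel] at h

end CycleStep

/-- (Lemma 7) Let `n ≥ 1` and let `M 0, …, M (n-1)` be finite-dimensional `ℂ`-vector spaces with
linear maps `a_i : M i → M (i+1 mod n)`, and let `τ_i : M i → M i` be the once-around-the-cycle
composition starting at `i`.  Then for every `λ ≠ 0`, the dimension of the generalized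
eigenspace of `τ_i` for `λ` is the same for all `i`. -/
theorem genEigenspace_dim_eq_of_cycle {n : ℕ} [NeZero n] (hn : 1 ≤ n)
    (M : ZMod n → Type*) [∀ i, AddCommGroup (M i)] [∀ i, Module ℂ (M i)]
    [∀ i, FiniteDimensional ℂ (M i)] (a : ∀ j : ZMod n, M (j - 1) →ₗ[ℂ] M j) :
    ∀ lam : ℂ, lam ≠ 0 → ∀ i i' : ZMod n,
      finrank ℂ ((cycleTau a i).maxGenEigenspace lam) =
        finrank ℂ ((cycleTau a i').maxGenEigenspace lam) := by
  intro lam hlam i i'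
  exact le_antisymm (finrank_maxGenEigenspace_cycleTau_le a hlam i i')
    (finrank_maxGenEigenspace_cycleTau_le a hlam i' i)
end

section
/- (Description of J(λ,r)) Let U be a finite-dimensional differentiation-invariant subspace of the space of functions ℝ → ℂ^q, with induced endomorphism D_U, and suppose that (D_U − λ·id)^r = 0 for some λ ∈ ℂ and integer r ≥ 1. Then for every g ∈ U there exist polynomials p_1, …, p_q ∈ ℂ[X], each of degree < r, such that the j-th component of g(t) equals exp(λ t)·p_j(t) for all t ∈ ℝ and all j. -/
open Polynomial in
theorem Polynomial.exists_derivative_eq_of_degree_lt {K : Type*} [Field K] [CharZero K] {n : ℕ}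
    {p : K[X]} (hp : p.degree < n) :
    ∃ P : K[X], P.degree < ((n + 1 : ℕ) : WithBot ℕ) ∧ derivative P = p := by
  refine ⟨∑ k ∈ Finset.range n, monomial (k + 1) (p.coeff k / (k + 1)), ?_, ?_⟩
  · refine mem_degreeLT.1 (Submodule.sum_mem _ fun k hk => mem_degreeLT.2 ?_)
    refine (degree_monomial_le _ _).trans_lt ?_
    exact_mod_cast Nat.succ_lt_succ (Finset.mem_range.1 hk)
  · have hcoeff (k : ℕ) : p.coeff k / (k + 1) * ((k + 1 : ℕ) : K) = p.coeff k := by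
      rw [Nat.cast_succ, div_mul_cancel₀ _ (Nat.cast_add_one_ne_zero k)]
    simp only [derivative_sum, derivative_monomial, hcoeff, Nat.add_sub_cancel]
    obtain rfl | hp0 := eq_or_ne p 0
    · simp
    · exact (p.as_sum_range' n ((natDegree_lt_iff_degree_lt hp0).2 hp)).symm

theorem exists_polynomial_of_deriv_sub_smul_eq {lam : ℂ} {f : ℝ → ℂ} (hf : Differentiable ℝ f)
    {n : ℕ} {p : Polynomial ℂ} (hp : p.degree < n)
    (h : ∀ t : ℝ, deriv f t - lam * f t = Complex.exp (lam * t) * p.eval (t : ℂ)) :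
    ∃ P : Polynomial ℂ, P.degree < ((n + 1 : ℕ) : WithBot ℕ) ∧
      ∀ t : ℝ, f t = Complex.exp (lam * t) * P.eval (t : ℂ) := by
  obtain ⟨P, hP, rfl⟩ := Polynomial.exists_derivative_eq_of_degree_lt hp
  set F : ℝ → ℂ := fun t => Complex.exp (-lam * t) * f t - P.eval (t : ℂ)
  have hF (t : ℝ) : HasDerivAt F 0 t := by
    have hexp : HasDerivAt (fun s : ℝ => Complex.exp (-lam * s))
        (Complex.exp (-lam * t) * (-lam * 1)) t :=
      (((hasDerivAt_id (t : ℂ)).const_mul (-lam)).cexp).comp_ofReal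
    refine ((hexp.mul (hf t).hasDerivAt).sub (P.hasDerivAt (t : ℂ)).comp_ofReal).congr_deriv ?_
    have hmul : Complex.exp (-lam * t) * Complex.exp (lam * t) = 1 := by
      rw [← Complex.exp_add]; simp
    linear_combination Complex.exp (-lam * t) * h t
      + (Polynomial.derivative P).eval (t : ℂ) * hmul
  have hconst (t : ℝ) : F t = F 0 :=
    is_const_of_deriv_eq_zero (fun s => (hF s).differentiableAt) (fun s => (hF s).deriv) t 0
  refine ⟨P + Polynomial.C (F 0), ?_, fun t => ?_⟩
  · refine (Polynomial.degree_add_le _ _).trans_lt (max_lt hP ?_)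
    exact Polynomial.degree_C_le.trans_lt (by exact_mod_cast n.succ_pos)
  · have hmul : Complex.exp (lam * t) * Complex.exp (-lam * t) = 1 := by
      rw [← Complex.exp_add]; simp
    have hFt : Complex.exp (-lam * t) * f t - P.eval (t : ℂ) = F 0 := hconst t
    rw [Polynomial.eval_add, Polynomial.eval_C, ← hFt]
    linear_combination -f t * hmul

/-- (Description of `J(λ,r)`) Let `U` be a finite-dimensional differentiation-invariant subspace
of the space of functions `ℝ → ℂ^q`, `D : U → U` the induced endomorphism `g ↦ deriv g`, and
suppose `(D − λ·id)^r = 0` with `r ≥ 1`.  Then every `g ∈ U` has components of the form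
`t ↦ exp (λ t) · p j (t)` with polynomials `p j` of degree `< r`. -/
theorem derivInvariant_nilpotent_eigen_form {q : ℕ} (U : Submodule ℂ (ℝ → Fin q → ℂ))
    [FiniteDimensional ℂ U]
    (hU : ∀ g ∈ U, Differentiable ℝ g ∧ deriv g ∈ U)
    (D : Module.End ℂ U)
    (hD : ∀ g : U, (D g : ℝ → Fin q → ℂ) = deriv (g : ℝ → Fin q → ℂ))
    (lam : ℂ) (r : ℕ) (hr : 1 ≤ r) (hnil : (D - lam • (1 : Module.End ℂ U)) ^ r = 0) :
    ∀ g ∈ U, ∃ p : Fin q → Polynomial ℂ,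
      (∀ j, (p j).degree < (r : WithBot ℕ)) ∧
      ∀ (t : ℝ) (j : Fin q), g t j = Complex.exp (lam * (t : ℂ)) * (p j).eval (t : ℂ) := by
  intro g hg
  suffices H : ∀ (n : ℕ) (g : U), ((D - lam • (1 : Module.End ℂ U)) ^ n) g = 0 →
      ∃ p : Fin q → Polynomial ℂ, (∀ j, (p j).degree < (n : WithBot ℕ)) ∧
        ∀ (t : ℝ) (j : Fin q),
          (g : ℝ → Fin q → ℂ) t j = Complex.exp (lam * (t : ℂ)) * (p j).eval (t : ℂ) from
    H r ⟨g, hg⟩ (by rw [hnil]; rfl)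
  intro n
  induction n with
  | zero =>
    intro g hg
    obtain rfl : g = 0 := hg
    exact ⟨0, fun j => by simp, fun t j => by simp⟩
  | succ n ih =>
    intro g hg
    rw [pow_succ, Module.End.mul_apply] at hg
    obtain ⟨p, hp, hgp⟩ := ih _ hg
    have hdiff := (hU g g.2).1
    have hstep (j : Fin q) := exists_polynomial_of_deriv_sub_smul_eq (lam := lam)
      (f := fun t => (g : ℝ → Fin q → ℂ) t j) (differentiable_pi.1 hdiff j) (hp j) fun t => by
        rw [← hgp t j, ← congrFun (deriv_pi fun j => differentiable_pi.1 hdiff j t) j]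
        simp [hD]
    choose P hP hPg using hstep
    exact ⟨P, hP, fun t j => hPg j t⟩
end

section
/- (Proposition 5, surjectivity, Jordan quiver case) Let U be a finite-dimensional differentiation-invariant subspace of the space of functions ℝ → ℂ^q, with induced endomorphism D_U : U → U. Then for every g ∈ U and every t ∈ ℝ one has g(t) = (exp(t • D_U)(g))(0), where exp(t • D_U) is the exponential of the endomorphism t·D_U of the finite-dimensional space U. In particular, the pair (D_U, ev_0), where ev_0 : U → ℂ^q is evaluation at 0, is stable: no nonzero D_U-invariant subspace of U is contained in ker ev_0. -/
open NormedSpace in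
/-- A differentiable operator-valued solution of `φ' = φ ∘ M` is `φ 0 ∘ exp (t M)`. -/
theorem hasSum_of_hasDerivAt_comp {V W : Type*} [NormedAddCommGroup V] [NormedSpace ℂ V]
    [CompleteSpace V] [NormedAddCommGroup W] [NormedSpace ℂ W] (M : V →L[ℂ] V)
    (φ : ℝ → V →L[ℂ] W) (hφ : ∀ t, HasDerivAt φ ((φ t).comp M) t) (v : V) (t : ℝ) :
    HasSum (fun i : ℕ => ((t : ℂ) ^ i / (i.factorial : ℂ)) • φ 0 ((M ^ i) v)) (φ t v) := by
  have hder : ∀ s, HasDerivAt (fun s : ℝ => (φ s).comp (exp (s • (-M)))) 0 s := by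
    intro s
    have hexp := hasDerivAt_exp_smul_const' (𝕂 := ℝ) (-M) s
    have hcomp := ((ContinuousLinearMap.compL ℂ V V W).bilinearRestrictScalars
      ℝ).hasFDerivAt_of_bilinear (hφ s).hasFDerivAt hexp.hasFDerivAt |>.hasDerivAt
    refine hcomp.congr_deriv ?_
    ext w
    simp
  have hconst : ∀ s, (φ s).comp (exp (s • (-M))) = φ 0 := by
    intro s
    have h := is_const_of_deriv_eq_zero (fun s => (hder s).differentiableAt)
      (fun s => (hder s).deriv) s 0
    rw [h, zero_smul, exp_zero]
    rfl
  have hφt : φ t = (φ 0).comp (exp ((t : ℂ) • M)) := by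
    have hinv : exp (t • (-M)) * exp ((t : ℂ) • M) = 1 := by
      let _ : NormedAlgebra ℚ (V →L[ℂ] V) := .restrictScalars ℚ ℂ (V →L[ℂ] V)
      rw [Complex.coe_smul, smul_neg,
        ← exp_add_of_commute (Commute.refl (t • M)).neg_left, neg_add_cancel, exp_zero]
    rw [← hconst t, ContinuousLinearMap.comp_assoc]
    change φ t = (φ t).comp (exp (t • (-M)) * exp ((t : ℂ) • M))
    rw [hinv]
    rfl
  have hsum := exp_series_hasSum_exp' (𝕂 := ℂ) ((t : ℂ) • M)
  have hsum_apply : HasSum _ (φ 0 (exp ((t : ℂ) • M) v)) :=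
    ((φ 0).comp (ContinuousLinearMap.apply ℂ V v)).hasSum hsum
  rw [hφt]
  refine hsum_apply.congr_fun ?_
  intro i
  simp [smul_pow, mul_smul, div_eq_inv_mul, -Complex.coe_smul]

/-- (Proposition 5, surjectivity, Jordan quiver case) Let `U` be a finite-dimensional
differentiation-invariant subspace of the functions `ℝ → ℂ^q` with induced endomorphism
`D : U → U`, `g ↦ deriv g`.  Then for every `g ∈ U` and `t ∈ ℝ` one has
`g t = (exp (t • D) g) 0`, i.e. the exponential series `Σ (tⁱ/i!) • (Dⁱ g) 0` sums to `g t`.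
In particular the pair `(D, ev₀)` is stable: no nonzero `D`-invariant subspace of `U` is
contained in the kernel of evaluation at `0`. -/
theorem derivInvariant_exp_eval_stable {q : ℕ} (U : Submodule ℂ (ℝ → Fin q → ℂ))
    [FiniteDimensional ℂ U]
    (hU : ∀ g ∈ U, Differentiable ℝ g ∧ deriv g ∈ U)
    (D : Module.End ℂ U)
    (hD : ∀ g : U, (D g : ℝ → Fin q → ℂ) = deriv (g : ℝ → Fin q → ℂ)) :
    (∀ (g : U) (t : ℝ),
      HasSum (fun i : ℕ => ((t : ℂ) ^ i / (i.factorial : ℂ)) • ((D ^ i) g : ℝ → Fin q → ℂ) 0)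
        ((g : ℝ → Fin q → ℂ) t)) ∧
    (∀ p : Submodule ℂ U, (∀ x ∈ p, D x ∈ p) →
      (∀ x ∈ p, (x : ℝ → Fin q → ℂ) 0 = 0) → p = ⊥) := by
  have hsum : ∀ (g : U) (t : ℝ),
      HasSum (fun i : ℕ => ((t : ℂ) ^ i / (i.factorial : ℂ)) • ((D ^ i) g : ℝ → Fin q → ℂ) 0)
        ((g : ℝ → Fin q → ℂ) t) := by
    intro g t
    let b := Module.finBasis ℂ U
    let e := b.equivFun
    let M := LinearMap.toContinuousLinearMap (e.conj D)
    let φ : ℝ → (Fin (Module.finrank ℂ U) → ℂ) →L[ℂ] (Fin q → ℂ) := fun s =>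
      ∑ j, (ContinuousLinearMap.proj j).smulRight ((b j : ℝ → Fin q → ℂ) s)
    have hφ_apply : ∀ s v, φ s v = (e.symm v : ℝ → Fin q → ℂ) s := by
      intro s v
      simp [φ, e, Module.Basis.equivFun_symm_apply]
    have hφ : ∀ s, HasDerivAt φ ((φ s).comp M) s := by
      intro s
      have hsmul : HasDerivAt φ (∑ j, (ContinuousLinearMap.proj j).smulRight
          ((D (b j) : ℝ → Fin q → ℂ) s)) s := by
        refine HasDerivAt.fun_sum fun j _ => ?_
        have hb := ((hU _ (b j).2).1 s).hasDerivAt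
        rw [← hD] at hb
        exact ((ContinuousLinearMap.smulRightL ℂ (Fin (Module.finrank ℂ U) → ℂ) (Fin q → ℂ)
          (ContinuousLinearMap.proj j)).restrictScalars ℝ).hasFDerivAt.comp_hasDerivAt s hb
      convert hsmul using 1
      ext1 v
      rw [ContinuousLinearMap.comp_apply, hφ_apply]
      simp [M, LinearEquiv.conj_apply, e, Module.Basis.equivFun_symm_apply]
    have hM : ∀ i : ℕ, e.symm ((M ^ i) (e g)) = (D ^ i) g := by
      intro i
      induction i with
      | zero => simp
      | succ i ih =>
        rw [pow_succ', pow_succ', mul_apply_eq_comp, Module.End.mul_apply, ← ih]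
        simp [M, LinearEquiv.conj_apply]
    simpa only [hφ_apply, hM, LinearEquiv.symm_apply_apply] using
      hasSum_of_hasDerivAt_comp M φ hφ (e g) t
  refine ⟨hsum, fun p hp h0 => (Submodule.eq_bot_iff p).2 fun x hx => ?_⟩
  have hpow : ∀ i : ℕ, (D ^ i) x ∈ p := by
    intro i
    induction i with
    | zero => simpa using hx
    | succ i ih =>
      rw [pow_succ', Module.End.mul_apply]
      exact hp _ ih
  ext1
  funext t
  refine (hsum x t).unique ?_
  simp only [h0 _ (hpow _), smul_zero]
  exact hasSum_zero
end
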